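/- Let (H_1, ⟨·,·⟩_1, l_1) and (H_2, ⟨·,·⟩_2, l_2) be Poincaré–Lefschetz spaces of dimensions n_1 and n_2 respectively, and suppose that Q_{l_1} and Q_{l_2} both satisfy the Hodge–Riemann–Minkowski relations. Form H = H_1 ⊗ H_2 with grading H^i = ⊕_{a+b=i} H_1^a ⊗ H_2^b, symmetric bilinear form determined by ⟨x_1 ⊗ x_2, y_1 ⊗ y_2⟩ = ⟨x_1, y_1⟩_1 · ⟨x_2, y_2⟩_2, and degree-2 map l = l_1 ⊗ id + id ⊗ l_2. Then (H, ⟨·,·⟩, l) is a Poincaré–Lefschetz space of dimension n_1 + n_2 and Q_l satisfies the Hodge–Riemann–Minkowski relations. -/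

import Mathlib

open scoped TensorProduct

/-- A Poincaré–Lefschetz space of dimension `n`: a finite-dimensional graded real
vector space `H = ⊕_{i=0}^{2n} H^i`, vanishing in odd degrees, with a symmetric
bilinear form pairing `H^i` with `H^{2n-i}` nondegenerately, and a self-adjoint
degree-2 operator `l`. -/
structure IsPLSpace {V : Type} [AddCommGroup V] [Module ℝ V]
    (n : ℕ) (H : ℤ → Submodule ℝ V) (B : LinearMap.BilinForm ℝ V)
    (l : Module.End ℝ V) : Prop where
  finite : FiniteDimensional ℝ V
  internal : DirectSum.IsInternal H
  bound : ∀ i : ℤ, (i < 0 ∨ (2 * n : ℤ) < i) → H i = ⊥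
  oddVanish : ∀ i : ℤ, Odd i → H i = ⊥
  symm : ∀ x y : V, B x y = B y x
  orthog : ∀ i j : ℤ, i + j ≠ 2 * n → ∀ x ∈ H i, ∀ y ∈ H j, B x y = 0
  nondeg : ∀ i : ℤ, ∀ x ∈ H i, (∀ y ∈ H (2 * n - i), B x y = 0) → x = 0
  deg2 : ∀ i : ℤ, (H i).map l ≤ H (i + 2)
  selfAdjoint : ∀ x y : V, B (l x) y = B x (l y)

/-- The quadratic forms `Q_l(x) = ⟨l^{n-d} x, x⟩` satisfy the
Hodge–Riemann–Minkowski relations: `(-1)^{d/2} Q_l` is positive definite on the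
primitive subspace `P^d = H^d ∩ ker l^{n-d+1}` for every even `0 ≤ d ≤ n`. -/
def SatisfiesHRM {V : Type} [AddCommGroup V] [Module ℝ V]
    (n : ℕ) (H : ℤ → Submodule ℝ V) (B : LinearMap.BilinForm ℝ V)
    (l : Module.End ℝ V) : Prop :=
  ∀ d : ℕ, d ≤ n → Even d →
    ∀ x ∈ H (d : ℤ) ⊓ LinearMap.ker (l ^ (n - d + 1)), x ≠ 0 →
      0 < (-1 : ℝ) ^ (d / 2) * B ((l ^ (n - d)) x) x

/-- The exponential of a nilpotent element of a real algebra. -/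
noncomputable def nilExp {A : Type*} [Ring A] [Algebra ℝ A] (a : A) : A :=
  letI : Module ℚ A := Module.compHom A (algebraMap ℚ ℝ)
  IsNilpotent.exp a

section NilExp

variable {A : Type*} [Ring A] [Algebra ℝ A]

theorem nilExp_eq_sum {a : A} {k : ℕ} (h : a ^ k = 0) :
    nilExp a = ∑ i ∈ Finset.range k, (i.factorial : ℝ)⁻¹ • a ^ i := by
  let _ : Module ℚ A := Module.compHom A (algebraMap ℚ ℝ)
  refine (IsNilpotent.exp_eq_sum h).trans (Finset.sum_congr rfl fun i _ => ?_)
  change (algebraMap ℚ ℝ _) • a ^ i = _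
  simp

theorem nilExp_add_of_commute {a b : A} (h : Commute a b) (ha : IsNilpotent a)
    (hb : IsNilpotent b) : nilExp (a + b) = nilExp a * nilExp b :=
  letI : Module ℚ A := Module.compHom A (algebraMap ℚ ℝ)
  IsNilpotent.exp_add_of_commute h ha hb

theorem nilExp_mul_nilExp_neg {a : A} (ha : IsNilpotent a) : nilExp a * nilExp (-a) = 1 :=
  letI : Module ℚ A := Module.compHom A (algebraMap ℚ ℝ)
  IsNilpotent.exp_mul_exp_neg_self ha

theorem nilExp_neg_mul_nilExp {a : A} (ha : IsNilpotent a) : nilExp (-a) * nilExp a = 1 :=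
  letI : Module ℚ A := Module.compHom A (algebraMap ℚ ℝ)
  IsNilpotent.exp_neg_mul_exp_self ha

theorem isUnit_nilExp {a : A} (ha : IsNilpotent a) : IsUnit (nilExp a) :=
  isUnit_iff_exists.mpr ⟨_, nilExp_mul_nilExp_neg ha, nilExp_neg_mul_nilExp ha⟩

theorem AlgHom.map_nilExp {A' : Type*} [Ring A'] [Algebra ℝ A'] (f : A →ₐ[ℝ] A') {a : A}
    (ha : IsNilpotent a) : f (nilExp a) = nilExp (f a) := by
  obtain ⟨k, hk⟩ := ha
  have hk' : f a ^ k = 0 := by rw [← map_pow, hk, map_zero]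
  simp [nilExp_eq_sum hk, nilExp_eq_sum hk']

theorem mul_pow_of_commutators {a b c d : A} (hb : b * a = a * b + c) (hc : c * a = a * c + d)
    (hd : d * a = a * d) (k : ℕ) :
    b * a ^ (k + 2) = a ^ (k + 2) * b + (k + 2 : ℝ) • (a ^ (k + 1) * c)
      + ((k + 2) * (k + 1) / 2 : ℝ) • (a ^ k * d) := by
  induction k with
  | zero =>
    have : b * a ^ 2 = a ^ 2 * b + (a * c + a * c) + d := by
      rw [pow_two, ← mul_assoc, hb, add_mul, mul_assoc, hb, hc]
      noncomm_ring
    simp only [zero_add, pow_one, pow_zero, one_mul, Nat.cast_zero, this]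
    module
  | succ k ih =>
    rw [pow_succ a (k + 2), ← mul_assoc, ih]
    have h1 : a ^ (k + 2) * b * a = a ^ (k + 2) * a * b + a ^ (k + 2) * c := by
      rw [mul_assoc, hb, mul_add, mul_assoc]
    have h2 : a ^ (k + 1) * c * a = a ^ (k + 2) * c + a ^ (k + 1) * d := by
      rw [mul_assoc, hc, mul_add, ← mul_assoc, ← pow_succ]
    have h3 : a ^ k * d * a = a ^ (k + 1) * d := by
      rw [mul_assoc, hd, ← mul_assoc, ← pow_succ]
    rw [add_mul, add_mul, smul_mul_assoc, smul_mul_assoc, h1, h2, h3]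
    push_cast
    module

/-- `e^{-a} b e^a = b + [b, a] + [[b, a], a] / 2` if the third iterated commutator vanishes. -/
theorem mul_nilExp_of_commutators {a b c d : A} (ha : IsNilpotent a) (hb : b * a = a * b + c)
    (hc : c * a = a * c + d) (hd : d * a = a * d) :
    b * nilExp a = nilExp a * (b + c + (1 / 2 : ℝ) • d) := by
  obtain ⟨k, hk⟩ := ha
  have hk1 : a ^ (k + 1) = 0 := by rw [pow_succ, hk, zero_mul]
  have hk2 : a ^ (k + 2) = 0 := by rw [pow_succ, hk1, zero_mul]
  have hbk (i : ℕ) : b * (((i + 2).factorial : ℝ)⁻¹ • a ^ (i + 2)) =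
      (((i + 2).factorial : ℝ)⁻¹ • a ^ (i + 2)) * b
      + (((i + 1).factorial : ℝ)⁻¹ • a ^ (i + 1)) * c
      + ((i.factorial : ℝ)⁻¹ • a ^ i) * ((1 / 2 : ℝ) • d) := by
    rw [mul_smul_comm, mul_pow_of_commutators hb hc hd]
    simp only [smul_mul_assoc, mul_smul_comm, smul_add, smul_smul, Nat.factorial_succ]
    push_cast
    have h1 : ((i + 1 + 1 : ℝ) * ((i + 1) * i.factorial))⁻¹ * (i + 2) =
        ((i + 1) * i.factorial : ℝ)⁻¹ := by
      field_simp
      ring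
    have h2 : ((i + 1 + 1 : ℝ) * ((i + 1) * i.factorial))⁻¹ * ((i + 2) * (i + 1) / 2) =
        (i.factorial : ℝ)⁻¹ * (1 / 2) := by
      field_simp
      ring
    rw [h1, h2, mul_comm (1 / 2 : ℝ)]
  rw [mul_add, mul_add]
  nth_rw 1 2 [nilExp_eq_sum hk2]
  rw [nilExp_eq_sum hk, Finset.sum_range_succ', Finset.sum_range_succ', mul_add, mul_add,
    Finset.mul_sum, Finset.sum_congr rfl fun i _ => hbk i, Finset.sum_add_distrib,
    Finset.sum_add_distrib, ← Finset.sum_mul, ← Finset.sum_mul, ← Finset.sum_mul,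
    ← nilExp_eq_sum hk]
  have hE := nilExp_eq_sum hk1
  rw [Finset.sum_range_succ'] at hE
  rw [hE]
  simp [add_mul, hb]
  abel

end NilExp

/-- Nilpotent elements `e`, `f` of a real algebra which, together with `h = [e, f]`, span a copy
of `𝔰𝔩₂` (or zero). -/
structure IsSl2Pair {A : Type*} [Ring A] [Algebra ℝ A] (e f : A) : Prop where
  nilpotent_e : IsNilpotent e
  nilpotent_f : IsNilpotent f
  h_mul_e : (e * f - f * e) * e = e * (e * f - f * e) + (2 : ℝ) • e
  h_mul_f : (e * f - f * e) * f = f * (e * f - f * e) - (2 : ℝ) • f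

/-- The Weyl element `exp(e) exp(-f) exp(e)`. -/
noncomputable def weyl {A : Type*} [Ring A] [Algebra ℝ A] (e f : A) : A :=
  nilExp e * nilExp (-f) * nilExp e

namespace IsSl2Pair

section Algebra

variable {A : Type*} [Ring A] [Algebra ℝ A] {e f : A}

theorem h_mul_exp_e (s : IsSl2Pair e f) :
    (e * f - f * e) * nilExp e = nilExp e * (e * f - f * e + (2 : ℝ) • e) := by
  rw [mul_nilExp_of_commutators (d := 0) s.nilpotent_e s.h_mul_e (by simp) (by simp)]
  simp

theorem f_mul_exp_e (s : IsSl2Pair e f) :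
    f * nilExp e = nilExp e * (f - (e * f - f * e) - e) := by
  rw [mul_nilExp_of_commutators (c := -(e * f - f * e)) (d := -((2 : ℝ) • e)) s.nilpotent_e
    (by noncomm_ring) (by rw [neg_mul, s.h_mul_e]; noncomm_ring) (by simp)]
  congr 1
  module

theorem e_mul_exp_e (s : IsSl2Pair e f) : e * nilExp e = nilExp e * e := by
  rw [mul_nilExp_of_commutators (c := 0) (d := 0) s.nilpotent_e (by simp) (by simp) (by simp)]
  simp

theorem h_mul_exp_neg_f (s : IsSl2Pair e f) :
    (e * f - f * e) * nilExp (-f) = nilExp (-f) * (e * f - f * e + (2 : ℝ) • f) := by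
  rw [mul_nilExp_of_commutators (c := (2 : ℝ) • f) (d := 0) s.nilpotent_f.neg
    (by rw [mul_neg, s.h_mul_f]; noncomm_ring) (by simp) (by simp)]
  simp

theorem e_mul_exp_neg_f (s : IsSl2Pair e f) :
    e * nilExp (-f) = nilExp (-f) * (e - (e * f - f * e) - f) := by
  rw [mul_nilExp_of_commutators (c := -(e * f - f * e)) (d := -((2 : ℝ) • f)) s.nilpotent_f.neg
    (by noncomm_ring) (by rw [neg_mul_neg, s.h_mul_f]; noncomm_ring) (by simp)]
  congr 1
  module

theorem f_mul_exp_neg_f (s : IsSl2Pair e f) : f * nilExp (-f) = nilExp (-f) * f := by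
  rw [mul_nilExp_of_commutators (c := 0) (d := 0) s.nilpotent_f.neg (by simp) (by simp) (by simp)]
  simp

theorem isUnit_weyl (s : IsSl2Pair e f) : IsUnit (weyl e f) :=
  ((isUnit_nilExp s.nilpotent_e).mul (isUnit_nilExp s.nilpotent_f.neg)).mul
    (isUnit_nilExp s.nilpotent_e)

theorem e_mul_weyl (s : IsSl2Pair e f) : e * weyl e f = -(weyl e f * f) := by
  calc e * weyl e f = nilExp e * (e * nilExp (-f)) * nilExp e := by
        rw [weyl, ← mul_assoc, ← mul_assoc, s.e_mul_exp_e, ← mul_assoc]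
    _ = nilExp e * nilExp (-f) * (e * nilExp e - (e * f - f * e) * nilExp e - f * nilExp e) := by
        rw [s.e_mul_exp_neg_f]; noncomm_ring
    _ = nilExp e * nilExp (-f) * (nilExp e * (-f)) := by
        rw [s.e_mul_exp_e, s.h_mul_exp_e, s.f_mul_exp_e, ← mul_sub, ← mul_sub]
        congr 2
        module
    _ = _ := by rw [weyl]; noncomm_ring

theorem f_mul_weyl (s : IsSl2Pair e f) : f * weyl e f = -(weyl e f * e) := by
  calc f * weyl e f = nilExp e * ((f - (e * f - f * e) - e) * nilExp (-f)) * nilExp e := by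
        rw [weyl, ← mul_assoc, ← mul_assoc, s.f_mul_exp_e]; noncomm_ring
    _ = nilExp e * (nilExp (-f) * (-e)) * nilExp e := by
        rw [sub_mul, sub_mul, s.e_mul_exp_neg_f, s.h_mul_exp_neg_f, s.f_mul_exp_neg_f, ← mul_sub,
          ← mul_sub]
        congr 3
        module
    _ = -(nilExp e * nilExp (-f) * (e * nilExp e)) := by noncomm_ring
    _ = _ := by rw [s.e_mul_exp_e, weyl]; noncomm_ring

theorem h_mul_weyl (s : IsSl2Pair e f) :
    (e * f - f * e) * weyl e f = -(weyl e f * (e * f - f * e)) := by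
  have he := s.e_mul_weyl
  have hf := s.f_mul_weyl
  calc (e * f - f * e) * weyl e f = e * (f * weyl e f) - f * (e * weyl e f) := by noncomm_ring
    _ = e * -(weyl e f * e) - f * -(weyl e f * f) := by rw [hf, he]
    _ = -(e * weyl e f * e) + f * weyl e f * f := by noncomm_ring
    _ = _ := by rw [he, hf, neg_mul, neg_mul, mul_assoc, mul_assoc, mul_sub]; abel

end Algebra

section Module

variable {V : Type*} [AddCommGroup V] [Module ℝ V] {e f : Module.End ℝ V}

theorem h_apply_e (s : IsSl2Pair e f) {x : V} {c : ℝ} (hx : (e * f - f * e) x = c • x) :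
    (e * f - f * e) (e x) = (c + 2) • e x := by
  have := LinearMap.congr_fun s.h_mul_e x
  rw [Module.End.mul_apply, LinearMap.add_apply, Module.End.mul_apply, hx] at this
  rw [this, map_smul, LinearMap.smul_apply, add_smul]

theorem h_apply_f (s : IsSl2Pair e f) {x : V} {c : ℝ} (hx : (e * f - f * e) x = c • x) :
    (e * f - f * e) (f x) = (c - 2) • f x := by
  have := LinearMap.congr_fun s.h_mul_f x
  rw [Module.End.mul_apply, LinearMap.sub_apply (f * _), Module.End.mul_apply f, hx] at this
  rw [this, map_smul, LinearMap.smul_apply, sub_smul]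

theorem h_apply_e_pow (s : IsSl2Pair e f) {x : V} {c : ℝ} (hx : (e * f - f * e) x = c • x)
    (k : ℕ) : (e * f - f * e) ((e ^ k) x) = (c + 2 * k) • (e ^ k) x := by
  induction k with
  | zero => simpa using hx
  | succ k ih =>
    rw [pow_succ', Module.End.mul_apply, s.h_apply_e ih]
    push_cast
    congr 1
    ring

theorem h_apply_f_pow (s : IsSl2Pair e f) {x : V} {c : ℝ} (hx : (e * f - f * e) x = c • x)
    (k : ℕ) : (e * f - f * e) ((f ^ k) x) = (c - 2 * k) • (f ^ k) x := by
  induction k with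
  | zero => simpa using hx
  | succ k ih =>
    rw [pow_succ', Module.End.mul_apply, s.h_apply_f ih]
    push_cast
    congr 1
    ring

theorem f_apply_e_pow_succ (s : IsSl2Pair e f) {x : V} {c : ℝ}
    (hx : (e * f - f * e) x = c • x) (k : ℕ) :
    f ((e ^ (k + 1)) x) = (e ^ k) (e (f x)) - ((k + 1) * (c + k)) • (e ^ k) x := by
  induction k with
  | zero =>
    simp only [LinearMap.sub_apply, Module.End.mul_apply] at hx
    simp [← hx]
  | succ k ih =>
    have h := s.h_apply_e_pow hx (k + 1)
    rw [LinearMap.sub_apply, Module.End.mul_apply, Module.End.mul_apply, sub_eq_iff_eq_add',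
      ← sub_eq_iff_eq_add, ih, map_sub, map_smul, ← Module.End.mul_apply e (e ^ k),
      ← Module.End.mul_apply e (e ^ k), ← pow_succ'] at h
    rw [pow_succ', Module.End.mul_apply, ← h]
    push_cast
    module

open Polynomial in
theorem aeval_apply_of_apply_eq_smul {h : Module.End ℝ V} {x : V} {c : ℝ} (hx : h x = c • x)
    (p : ℝ[X]) : aeval h p x = p.eval c • x := by
  by_cases h0 : x = 0
  · simp [h0]
  · exact Module.End.aeval_apply_of_hasEigenvector
      ⟨Module.End.mem_eigenspace_iff.mpr hx, h0⟩

open Polynomial in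
theorem weyl_apply (s : IsSl2Pair e f) {x : V} {m : ℕ} (hf : f x = 0)
    (hx : (e * f - f * e) x = (-m : ℝ) • x) (he : (e ^ (m + 1)) x = 0) :
    weyl e f x = (m.factorial : ℝ)⁻¹ • (e ^ m) x := by
  set u := weyl e f x with hu
  have heu : e u = 0 := by
    have := LinearMap.congr_fun s.e_mul_weyl x
    simpa [hf] using this
  have hhu : (e * f - f * e) u = (m : ℝ) • u := by
    have := LinearMap.congr_fun s.h_mul_weyl x
    rw [Module.End.mul_apply, LinearMap.neg_apply, Module.End.mul_apply, hx] at this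
    rw [this]
    simp [hu]
  obtain ⟨a, ha⟩ := s.nilpotent_e
  obtain ⟨b, hb⟩ := s.nilpotent_f
  let N := a + b + m + 1
  have hNe : e ^ N = 0 := pow_eq_zero_of_le (by omega) ha
  have hNf : f ^ N = 0 := pow_eq_zero_of_le (by omega) hb
  have hexpu : nilExp (-e) u = u := by
    rw [nilExp_eq_sum (show (-e) ^ N = 0 by rw [neg_pow, hNe, mul_zero]), LinearMap.sum_apply,
      Finset.sum_eq_single 0]
    · simp
    · intro i _ hi
      obtain ⟨j, rfl⟩ := Nat.exists_eq_succ_of_ne_zero hi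
      simp [pow_succ, heu]
    · simp [N]
  have hE : nilExp e x = nilExp f u := by
    have h1 : nilExp f * nilExp (-e) * weyl e f = nilExp e := by
      have h2 := nilExp_neg_mul_nilExp s.nilpotent_e
      have h3 := nilExp_mul_nilExp_neg s.nilpotent_f
      calc _ = nilExp f * (nilExp (-e) * nilExp e) * nilExp (-f) * nilExp e := by
            rw [weyl]; noncomm_ring
        _ = _ := by rw [h2, mul_one, h3, one_mul]
    rw [← h1, Module.End.mul_apply, Module.End.mul_apply, ← hu, hexpu]
  rw [nilExp_eq_sum hNe, nilExp_eq_sum hNf, LinearMap.sum_apply, LinearMap.sum_apply] at hE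
  let Q : ℝ[X] := ∏ k ∈ Finset.range N, (X - C (m - 2 * (k + 1) : ℝ))
  have hQ0 (k : ℕ) (hk : k < N) (hk0 : k ≠ 0) : Q.eval (m - 2 * k : ℝ) = 0 := by
    rw [eval_prod]
    refine Finset.prod_eq_zero (i := k - 1) (Finset.mem_range.mpr (by omega)) ?_
    obtain ⟨j, rfl⟩ := Nat.exists_eq_succ_of_ne_zero hk0
    simp
  have hQm : Q.eval (m : ℝ) ≠ 0 := by
    rw [eval_prod]
    refine Finset.prod_ne_zero_iff.mpr fun k _ => ?_
    simp only [eval_sub, eval_X, eval_C, sub_sub_cancel]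
    positivity
  have key := congrArg (aeval (e * f - f * e) Q) hE
  simp only [map_sum, LinearMap.smul_apply, map_smul,
    aeval_apply_of_apply_eq_smul (s.h_apply_e_pow hx _),
    aeval_apply_of_apply_eq_smul (s.h_apply_f_pow hhu _)] at key
  rw [Finset.sum_eq_single m, Finset.sum_eq_single 0] at key
  · have h2 : (-m + 2 * m : ℝ) = m := by ring
    rw [h2, smul_comm] at key
    simp only [Nat.factorial_zero, Nat.cast_one, inv_one, one_smul, Nat.cast_zero, mul_zero,
      sub_zero, pow_zero, Module.End.one_apply] at key
    exact (smul_right_injective V hQm key).symm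
  · intro k hk hk0
    rw [hQ0 k (Finset.mem_range.mp hk) hk0, zero_smul, smul_zero]
  · simp [N]
  · intro k hk hkm
    rcases lt_or_gt_of_ne hkm with h | h
    · have := hQ0 (m - k) (by omega) (by omega)
      rw [Nat.cast_sub h.le] at this
      rw [show (-m + 2 * k : ℝ) = m - 2 * (m - k) by ring, this, zero_smul, smul_zero]
    · obtain ⟨j, rfl⟩ := Nat.exists_eq_add_of_lt h
      rw [show m + j + 1 = j + (m + 1) by ring, pow_add, Module.End.mul_apply, he]
      simp
  · intro h
    exact absurd (Finset.mem_range.mpr (by omega)) h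

end Module

end IsSl2Pair

theorem selfAdjoint_pow {V : Type*} [AddCommGroup V] [Module ℝ V] {B : LinearMap.BilinForm ℝ V}
    {l : Module.End ℝ V} (hl : ∀ x y, B (l x) y = B x (l y)) (k : ℕ) (x y : V) :
    B ((l ^ k) x) y = B x ((l ^ k) y) := by
  induction k generalizing x with
  | zero => rfl
  | succ k ih => rw [pow_succ, Module.End.mul_apply, ih, hl, ← Module.End.mul_apply, ← pow_succ',
      pow_succ]

/-- A polarization of a graded space with form `B`: an extension of `e` to an `𝔰𝔩₂`-action whose
weights are given by the grading, such that the form `B (c x) (w y)` is an inner product, where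
`w` is the Weyl element and `c` is multiplication by `(-1)^i` in degree `2i`. -/
structure IsPolarization {V : Type} [AddCommGroup V] [Module ℝ V]
    (n : ℕ) (H : ℤ → Submodule ℝ V) (B : LinearMap.BilinForm ℝ V)
    (e f c : Module.End ℝ V) : Prop where
  sl2 : IsSl2Pair e f
  weight : ∀ i : ℤ, ∀ x ∈ H i, (e * f - f * e) x = (i - n : ℝ) • x
  c_mul_c : c * c = 1
  c_mul_e : c * e = -(e * c)
  c_mul_f : c * f = -(f * c)
  c_apply : ∀ i : ℤ, ∀ x ∈ H (2 * i), c x = (-1 : ℝ) ^ i • x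
  form_symm : ∀ x y : V, B (c x) (weyl e f y) = B (c y) (weyl e f x)
  form_pos : ∀ x : V, x ≠ 0 → 0 < B (c x) (weyl e f x)

namespace IsPolarization

variable {V : Type} [AddCommGroup V] [Module ℝ V] {n : ℕ} {H : ℤ → Submodule ℝ V}
  {B : LinearMap.BilinForm ℝ V} {e f c : Module.End ℝ V}

theorem form_e_left (p : IsPolarization n H B e f c) (he : ∀ x y, B (e x) y = B x (e y))
    (x y : V) : B (c (e x)) (weyl e f y) = B (c x) (weyl e f (f y)) := by
  have h1 := LinearMap.congr_fun p.c_mul_e x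
  have h2 := LinearMap.congr_fun p.sl2.e_mul_weyl y
  simp only [Module.End.mul_apply, LinearMap.neg_apply] at h1 h2
  rw [h1, map_neg, LinearMap.neg_apply, he, h2, map_neg, neg_neg]

theorem form_e_right (p : IsPolarization n H B e f c) (he : ∀ x y, B (e x) y = B x (e y))
    (x y : V) : B (c x) (weyl e f (e y)) = B (c (f x)) (weyl e f y) := by
  rw [p.form_symm, p.form_e_left he, p.form_symm]

theorem f_selfAdjoint (p : IsPolarization n H B e f c) (he : ∀ x y, B (e x) y = B x (e y))
    (x y : V) : B (f x) y = B x (f y) := by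
  have hcc : c (c x) = x := LinearMap.congr_fun p.c_mul_c x
  obtain ⟨w', hw', -⟩ := isUnit_iff_exists.mp p.sl2.isUnit_weyl
  have hwy : weyl e f (w' y) = y := LinearMap.congr_fun hw' y
  have h1 := p.form_e_right he (c x) (w' y)
  have h2 := LinearMap.congr_fun p.c_mul_f (c x)
  have h3 := LinearMap.congr_fun p.sl2.f_mul_weyl (w' y)
  simp only [Module.End.mul_apply, LinearMap.neg_apply] at h2 h3
  rw [h2, hcc, hwy, map_neg, LinearMap.neg_apply] at h1
  rw [hwy] at h3
  rw [h3, map_neg, h1, neg_neg]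

theorem eq_zero_of_e_pow (p : IsPolarization n H B e f c) (he : ∀ x y, B (e x) y = B x (e y))
    {m j : ℕ} (hj : j ≤ m) {z : V} (hz : (e * f - f * e) z = (-m : ℝ) • z)
    (h0 : (e ^ j) z = 0) : z = 0 := by
  induction j generalizing z with
  | zero => simpa using h0
  | succ j ih =>
    have h1 := p.sl2.f_apply_e_pow_succ hz j
    have h2 := p.sl2.h_apply_e (p.sl2.h_apply_f hz)
    rw [sub_add_cancel] at h2
    have hpos : (0 : ℝ) < (j + 1) * (m - j) := by
      have : (j : ℝ) + 1 ≤ m := by exact_mod_cast hj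
      exact mul_pos (by positivity) (by linarith)
    have h3 : e (f z) + ((j + 1) * (m - j) : ℝ) • z = 0 := by
      refine ih (by omega) ?_ ?_
      · rw [map_add, map_smul, h2, hz, smul_add, smul_comm]
      · rw [h0, map_zero] at h1
        rw [map_add, map_smul, h1]
        module
    have h4 := congrArg (fun y => B (c z) (weyl e f y)) h3
    simp only [map_add, map_smul, map_zero, p.form_e_right he, smul_eq_mul] at h4
    by_contra hne
    have h5 : 0 ≤ B (c (f z)) (weyl e f (f z)) := by
      by_cases h : f z = 0
      · simp [h]
      · exact (p.form_pos _ h).le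
    have h6 := mul_pos hpos (p.form_pos z hne)
    linarith

theorem f_apply_eq_zero (p : IsPolarization n H B e f c) (he : ∀ x y, B (e x) y = B x (e y))
    {m : ℕ} {x : V} (hx : (e * f - f * e) x = (-m : ℝ) • x) (h0 : (e ^ (m + 1)) x = 0) :
    f x = 0 := by
  have h1 := p.sl2.f_apply_e_pow_succ hx m
  rw [h0, map_zero, neg_add_cancel, mul_zero, zero_smul, sub_zero] at h1
  have h2 := p.sl2.h_apply_e (p.sl2.h_apply_f hx)
  rw [sub_add_cancel] at h2
  have h3 := p.eq_zero_of_e_pow he le_rfl h2 h1.symm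
  by_contra hne
  have h4 := p.form_pos _ hne
  rw [← p.form_e_right he, h3] at h4
  simp at h4

theorem satisfiesHRM (p : IsPolarization n H B e f c) (he : ∀ x y, B (e x) y = B x (e y)) :
    SatisfiesHRM n H B e := by
  rintro d hd ⟨k, rfl⟩ x ⟨hxH, hxk⟩ hx0
  replace hxk : (e ^ (n - (k + k) + 1)) x = 0 := hxk
  set m := n - (k + k) with hm
  have hw : (e * f - f * e) x = (-m : ℝ) • x := by
    rw [p.weight _ x hxH, hm, Nat.cast_sub hd]
    simp
  have hc : c x = (-1 : ℝ) ^ k • x := by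
    rw [← zpow_natCast]
    refine p.c_apply k x ?_
    rw [two_mul]
    exact_mod_cast hxH
  have hpos := p.form_pos x hx0
  rw [p.sl2.weyl_apply (p.f_apply_eq_zero he hw hxk) hw hxk, hc, map_smul, map_smul,
    LinearMap.smul_apply, smul_eq_mul, smul_eq_mul] at hpos
  rw [selfAdjoint_pow he, show (k + k) / 2 = k by omega]
  exact (pos_iff_pos_of_mul_pos hpos).mp (by positivity)

theorem isPLSpace (p : IsPolarization n H B e f c) [FiniteDimensional ℝ V] (hH : ⨆ i, H i = ⊤)
    (bound : ∀ i : ℤ, (i < 0 ∨ (2 * n : ℤ) < i) → H i = ⊥) (oddVanish : ∀ i : ℤ, Odd i → H i = ⊥)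
    (symm : ∀ x y : V, B x y = B y x) (deg2 : ∀ i : ℤ, (H i).map e ≤ H (i + 2))
    (he : ∀ x y, B (e x) y = B x (e y)) : IsPLSpace n H B e := by
  have hf := p.f_selfAdjoint he
  have orthog : ∀ i j : ℤ, i + j ≠ 2 * n → ∀ x ∈ H i, ∀ y ∈ H j, B x y = 0 := by
    intro i j hij x hx y hy
    have h1 : B ((e * f - f * e) x) y = -B x ((e * f - f * e) y) := by
      simp [he, hf]
    rw [p.weight i x hx, p.weight j y hy, map_smul, map_smul, LinearMap.smul_apply, smul_eq_mul,
      smul_eq_mul] at h1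
    have h2 : ((i + j - 2 * n : ℤ) : ℝ) * B x y = 0 := by
      push_cast
      linear_combination h1
    exact (mul_eq_zero.mp h2).resolve_left (by exact_mod_cast sub_ne_zero.mpr hij)
  refine ⟨inferInstance, ?_, bound, oddVanish, symm, orthog, ?_, deg2, he⟩
  · refine DirectSum.isInternal_submodule_of_iSupIndep_of_iSup_eq_top ?_ hH
    have hinj : Function.Injective fun i : ℤ => (i - n : ℝ) := fun i j h => by simpa using h
    refine ((Module.End.eigenspaces_iSupIndep (e * f - f * e)).comp hinj).mono fun i x hx => ?_
    exact Module.End.mem_eigenspace_iff.mpr (p.weight i x hx)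
  · intro i x hx h0
    have h1 (y : V) : B x y = 0 := by
      refine Submodule.iSup_induction H (motive := fun y => B x y = 0)
        (hH ▸ Submodule.mem_top : y ∈ ⨆ i, H i) (fun j y hy => ?_) (map_zero _)
        fun y z hy hz => by rw [map_add, hy, hz, add_zero]
      by_cases hj : i + j = 2 * n
      · exact h0 y ((show j = 2 * n - i by omega) ▸ hy)
      · exact orthog i j hj x hx y hy
    have hcc : c (c x) = x := LinearMap.congr_fun p.c_mul_c x
    by_contra hne
    have hpos := p.form_pos (c x) fun h => hne (by rw [← hcc, h, map_zero])
    rw [hcc, h1] at hpos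
    exact hpos.false

end IsPolarization

theorem nilExp_neg_add {A : Type*} [Ring A] [Algebra ℝ A] {a b : A} (h : Commute a b)
    (ha : IsNilpotent a) (hb : IsNilpotent b) : nilExp (-(a + b)) = nilExp (-a) * nilExp (-b) := by
  rw [neg_add, nilExp_add_of_commute h.neg_left.neg_right ha.neg hb.neg]

namespace IsSl2Pair

theorem add_bracket {A : Type*} [Ring A] {e₁ f₁ e₂ f₂ : A} (hef : Commute e₁ f₂)
    (hfe : Commute f₁ e₂) :
    (e₁ + e₂) * (f₁ + f₂) - (f₁ + f₂) * (e₁ + e₂) =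
      (e₁ * f₁ - f₁ * e₁) + (e₂ * f₂ - f₂ * e₂) := by
  have h1 := hef.eq
  have h2 := hfe.eq
  simp only [add_mul, mul_add, h1, h2]
  abel

variable {A A' : Type*} [Ring A] [Algebra ℝ A] [Ring A'] [Algebra ℝ A']

theorem map {e f : A} (s : IsSl2Pair e f) (φ : A →ₐ[ℝ] A') : IsSl2Pair (φ e) (φ f) where
  nilpotent_e := s.nilpotent_e.map φ
  nilpotent_f := s.nilpotent_f.map φ
  h_mul_e := by simpa using congrArg φ s.h_mul_e
  h_mul_f := by simpa using congrArg φ s.h_mul_f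

theorem map_weyl {e f : A} (s : IsSl2Pair e f) (φ : A →ₐ[ℝ] A') :
    φ (weyl e f) = weyl (φ e) (φ f) := by
  simp [weyl, φ.map_nilExp s.nilpotent_e, φ.map_nilExp s.nilpotent_f.neg]

theorem add {e₁ f₁ e₂ f₂ : A} (s₁ : IsSl2Pair e₁ f₁) (s₂ : IsSl2Pair e₂ f₂)
    (hee : Commute e₁ e₂) (hef : Commute e₁ f₂) (hfe : Commute f₁ e₂) (hff : Commute f₁ f₂) :
    IsSl2Pair (e₁ + e₂) (f₁ + f₂) where
  nilpotent_e := hee.isNilpotent_add s₁.nilpotent_e s₂.nilpotent_e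
  nilpotent_f := hff.isNilpotent_add s₁.nilpotent_f s₂.nilpotent_f
  h_mul_e := by
    have h1 : Commute (e₁ * f₁ - f₁ * e₁) e₂ :=
      (hee.mul_left hfe).sub_left (hfe.mul_left hee)
    have h2 : Commute (e₂ * f₂ - f₂ * e₂) e₁ :=
      (hee.symm.mul_left hef.symm).sub_left (hef.symm.mul_left hee.symm)
    rw [add_bracket hef hfe, add_mul, mul_add, mul_add, s₁.h_mul_e, s₂.h_mul_e, h1.eq, h2.eq,
      add_mul, mul_add, mul_add, smul_add]
    abel
  h_mul_f := by
    have h1 : Commute (e₁ * f₁ - f₁ * e₁) f₂ :=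
      (hef.mul_left hff).sub_left (hff.mul_left hef)
    have h2 : Commute (e₂ * f₂ - f₂ * e₂) f₁ :=
      (hfe.symm.mul_left hff.symm).sub_left (hff.symm.mul_left hfe.symm)
    rw [add_bracket hef hfe, add_mul, mul_add, mul_add, s₁.h_mul_f, s₂.h_mul_f, h1.eq, h2.eq,
      add_mul, mul_add, mul_add, smul_add]
    abel

theorem weyl_add {e₁ f₁ e₂ f₂ : A} (s₁ : IsSl2Pair e₁ f₁) (s₂ : IsSl2Pair e₂ f₂)
    (hee : Commute e₁ e₂) (hff : Commute f₁ f₂)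
    (h₁ : Commute (nilExp (-f₁)) (nilExp e₂)) (h₂ : Commute (nilExp e₁) (nilExp (-f₂)))
    (h₃ : Commute (nilExp e₁) (nilExp e₂)) :
    weyl (e₁ + e₂) (f₁ + f₂) = weyl e₁ f₁ * weyl e₂ f₂ := by
  rw [weyl, weyl, weyl, nilExp_add_of_commute hee s₁.nilpotent_e s₂.nilpotent_e,
    nilExp_neg_add hff s₁.nilpotent_f s₂.nilpotent_f]
  set E₁ := nilExp e₁
  set E₂ := nilExp e₂
  set F₁ := nilExp (-f₁)
  set F₂ := nilExp (-f₂)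
  calc E₁ * E₂ * (F₁ * F₂) * (E₁ * E₂) = E₁ * (E₂ * F₁) * (F₂ * E₁) * E₂ := by noncomm_ring
    _ = E₁ * F₁ * (E₂ * E₁) * F₂ * E₂ := by rw [← h₁.eq, ← h₂.eq]; noncomm_ring
    _ = _ := by rw [← h₃.eq]; noncomm_ring

end IsSl2Pair

section TensorForm

variable {V₁ V₂ : Type*} [AddCommGroup V₁] [Module ℝ V₁] [AddCommGroup V₂] [Module ℝ V₂]
  {G₁ : LinearMap.BilinForm ℝ V₁} {G₂ : LinearMap.BilinForm ℝ V₂}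
  {G : LinearMap.BilinForm ℝ (V₁ ⊗[ℝ] V₂)}

theorem tensorForm_symm
    (hG : ∀ x₁ y₁ x₂ y₂, G (x₁ ⊗ₜ[ℝ] x₂) (y₁ ⊗ₜ[ℝ] y₂) = G₁ x₁ y₁ * G₂ x₂ y₂)
    (h₁ : ∀ x y, G₁ x y = G₁ y x) (h₂ : ∀ x y, G₂ x y = G₂ y x) (x y : V₁ ⊗[ℝ] V₂) :
    G x y = G y x := by
  have : G = G.flip := by
    ext x₁ x₂ y₁ y₂
    simp [hG, h₁ x₁, h₂ x₂]
  exact LinearMap.congr_fun (LinearMap.congr_fun this x) y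

theorem tensorForm_pos [FiniteDimensional ℝ V₁] [FiniteDimensional ℝ V₂]
    (hG : ∀ x₁ y₁ x₂ y₂, G (x₁ ⊗ₜ[ℝ] x₂) (y₁ ⊗ₜ[ℝ] y₂) = G₁ x₁ y₁ * G₂ x₂ y₂)
    (h₁ : ∀ x y, G₁ x y = G₁ y x) (h₂ : ∀ x y, G₂ x y = G₂ y x)
    (p₁ : ∀ x, x ≠ 0 → 0 < G₁ x x) (p₂ : ∀ x, x ≠ 0 → 0 < G₂ x x) {x : V₁ ⊗[ℝ] V₂}
    (hx : x ≠ 0) : 0 < G x x := by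
  have : Invertible (2 : ℝ) := invertibleOfNonzero two_ne_zero
  obtain ⟨v₁, hv₁⟩ := LinearMap.BilinForm.exists_orthogonal_basis (B := G₁) ⟨h₁⟩
  obtain ⟨v₂, hv₂⟩ := LinearMap.BilinForm.exists_orthogonal_basis (B := G₂) ⟨h₂⟩
  rw [LinearMap.isOrthoᵢ_def] at hv₁ hv₂
  let v := v₁.tensorProduct v₂
  have hvv (i j) : G (v i) (v j) = if i = j then G₁ (v₁ i.1) (v₁ i.1) * G₂ (v₂ i.2) (v₂ i.2)
      else 0 := by
    rw [Module.Basis.tensorProduct_apply, Module.Basis.tensorProduct_apply, hG]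
    split_ifs with h
    · rw [h]
    · by_cases h1 : i.1 = j.1
      · rw [hv₂ i.2 j.2 fun h2 => h (Prod.ext h1 h2), mul_zero]
      · rw [hv₁ i.1 j.1 h1, zero_mul]
  have hGx : G x x = ∑ i, (v.repr x i) ^ 2 * (G₁ (v₁ i.1) (v₁ i.1) * G₂ (v₂ i.2) (v₂ i.2)) := by
    conv_lhs => rw [← v.sum_repr x]
    simp only [map_sum, map_smul, LinearMap.sum_apply, LinearMap.smul_apply, hvv, smul_eq_mul,
      mul_ite, mul_zero, Finset.sum_ite_eq', Finset.mem_univ, if_true]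
    exact Finset.sum_congr rfl fun i _ => by ring
  have hpos (i : Fin (Module.finrank ℝ V₁) × Fin (Module.finrank ℝ V₂)) :
      0 < G₁ (v₁ i.1) (v₁ i.1) * G₂ (v₂ i.2) (v₂ i.2) :=
    mul_pos (p₁ _ (v₁.ne_zero _)) (p₂ _ (v₂.ne_zero _))
  obtain ⟨i, hi⟩ : ∃ i, v.repr x i ≠ 0 := by
    by_contra! h
    exact hx (v.repr.map_eq_zero_iff.mp (Finsupp.ext h))
  rw [hGx]
  exact Finset.sum_pos' (fun i _ => mul_nonneg (sq_nonneg _) (hpos i).le)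
    ⟨i, Finset.mem_univ _, mul_pos (by positivity) (hpos i)⟩

end TensorForm

section TensorGrading

variable {V₁ V₂ : Type} [AddCommGroup V₁] [Module ℝ V₁] [AddCommGroup V₂] [Module ℝ V₂]
  {H₁ : ℤ → Submodule ℝ V₁} {H₂ : ℤ → Submodule ℝ V₂} {H : ℤ → Submodule ℝ (V₁ ⊗[ℝ] V₂)}

theorem tensorGrading_le
    (hH : ∀ i : ℤ, H i = ⨆ a : ℤ,
      LinearMap.range (TensorProduct.map ((H₁ a).subtype) ((H₂ (i - a)).subtype)))
    {i : ℤ} {W : Submodule ℝ (V₁ ⊗[ℝ] V₂)}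
    (h : ∀ a b : ℤ, a + b = i → ∀ x ∈ H₁ a, ∀ y ∈ H₂ b, x ⊗ₜ[ℝ] y ∈ W) : H i ≤ W := by
  rw [hH]
  refine iSup_le fun a => ?_
  rw [TensorProduct.range_mapIncl, Submodule.map₂_le]
  exact h a (i - a) (by ring)

theorem tmul_mem_tensorGrading
    (hH : ∀ i : ℤ, H i = ⨆ a : ℤ,
      LinearMap.range (TensorProduct.map ((H₁ a).subtype) ((H₂ (i - a)).subtype)))
    {i a b : ℤ} (hab : a + b = i) {x : V₁} {y : V₂} (hx : x ∈ H₁ a) (hy : y ∈ H₂ b) :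
    x ⊗ₜ[ℝ] y ∈ H i := by
  obtain rfl : b = i - a := by omega
  rw [hH]
  refine Submodule.mem_iSup_of_mem a ?_
  exact ⟨⟨x, hx⟩ ⊗ₜ ⟨y, hy⟩, by simp⟩

theorem iSup_tensorGrading
    (hH : ∀ i : ℤ, H i = ⨆ a : ℤ,
      LinearMap.range (TensorProduct.map ((H₁ a).subtype) ((H₂ (i - a)).subtype)))
    (h₁ : ⨆ i, H₁ i = ⊤) (h₂ : ⨆ i, H₂ i = ⊤) : ⨆ i, H i = ⊤ := by
  rw [eq_top_iff, ← TensorProduct.map₂_mk_top_top_eq_top, ← h₁, ← h₂, Submodule.map₂_iSup_left]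
  refine iSup_le fun a => ?_
  rw [Submodule.map₂_iSup_right]
  refine iSup_le fun b => Submodule.map₂_le.mpr fun x hx y hy => ?_
  exact Submodule.mem_iSup_of_mem (a + b) (tmul_mem_tensorGrading hH rfl hx hy)

end TensorGrading

open Module.End in
theorem IsPolarization.tensor {V₁ V₂ : Type} [AddCommGroup V₁] [Module ℝ V₁]
    [AddCommGroup V₂] [Module ℝ V₂] [FiniteDimensional ℝ V₁] [FiniteDimensional ℝ V₂]
    {n₁ n₂ : ℕ} {H₁ : ℤ → Submodule ℝ V₁} {H₂ : ℤ → Submodule ℝ V₂}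
    {B₁ : LinearMap.BilinForm ℝ V₁} {B₂ : LinearMap.BilinForm ℝ V₂}
    {e₁ f₁ c₁ : Module.End ℝ V₁} {e₂ f₂ c₂ : Module.End ℝ V₂}
    (p₁ : IsPolarization n₁ H₁ B₁ e₁ f₁ c₁) (p₂ : IsPolarization n₂ H₂ B₂ e₂ f₂ c₂)
    (odd₁ : ∀ i : ℤ, Odd i → H₁ i = ⊥)
    {B : LinearMap.BilinForm ℝ (V₁ ⊗[ℝ] V₂)}
    (hB : ∀ (x₁ y₁ : V₁) (x₂ y₂ : V₂),
      B (x₁ ⊗ₜ[ℝ] x₂) (y₁ ⊗ₜ[ℝ] y₂) = B₁ x₁ y₁ * B₂ x₂ y₂)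
    {H : ℤ → Submodule ℝ (V₁ ⊗[ℝ] V₂)}
    (hH : ∀ i : ℤ, H i = ⨆ a : ℤ,
      LinearMap.range (TensorProduct.map ((H₁ a).subtype) ((H₂ (i - a)).subtype))) :
    IsPolarization (n₁ + n₂) H B
      (rTensorAlgHom ℝ V₁ V₂ e₁ + lTensorAlgHom ℝ V₂ V₁ e₂)
      (rTensorAlgHom ℝ V₁ V₂ f₁ + lTensorAlgHom ℝ V₂ V₁ f₂)
      (rTensorAlgHom ℝ V₁ V₂ c₁ * lTensorAlgHom ℝ V₂ V₁ c₂) := by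
  set ρ₁ := rTensorAlgHom ℝ V₁ V₂
  set ρ₂ := lTensorAlgHom ℝ V₂ V₁
  have hρ₁ (a : Module.End ℝ V₁) (x : V₁) (y : V₂) : ρ₁ a (x ⊗ₜ[ℝ] y) = a x ⊗ₜ[ℝ] y := rfl
  have hρ₂ (b : Module.End ℝ V₂) (x : V₁) (y : V₂) : ρ₂ b (x ⊗ₜ[ℝ] y) = x ⊗ₜ[ℝ] b y := rfl
  have comm (a : Module.End ℝ V₁) (b : Module.End ℝ V₂) : Commute (ρ₁ a) (ρ₂ b) :=
    TensorProduct.ext' fun x y => rfl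
  have hweyl : weyl (ρ₁ e₁ + ρ₂ e₂) (ρ₁ f₁ + ρ₂ f₂) = ρ₁ (weyl e₁ f₁) * ρ₂ (weyl e₂ f₂) := by
    rw [p₁.sl2.map_weyl, p₂.sl2.map_weyl]
    refine (p₁.sl2.map ρ₁).weyl_add (p₂.sl2.map ρ₂) (comm _ _) (comm _ _) ?_ ?_ ?_ <;>
    simp only [← map_neg, ← ρ₁.map_nilExp p₁.sl2.nilpotent_e, ← ρ₂.map_nilExp p₂.sl2.nilpotent_e,
      ← ρ₁.map_nilExp p₁.sl2.nilpotent_f.neg, ← ρ₂.map_nilExp p₂.sl2.nilpotent_f.neg] <;>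
    exact comm _ _
  let G₁ : LinearMap.BilinForm ℝ V₁ := B₁.compl₁₂ c₁ (weyl e₁ f₁)
  let G₂ : LinearMap.BilinForm ℝ V₂ := B₂.compl₁₂ c₂ (weyl e₂ f₂)
  let G : LinearMap.BilinForm ℝ (V₁ ⊗[ℝ] V₂) :=
    B.compl₁₂ (ρ₁ c₁ * ρ₂ c₂) (ρ₁ (weyl e₁ f₁) * ρ₂ (weyl e₂ f₂))
  have hG (x₁ y₁ x₂ y₂) : G (x₁ ⊗ₜ[ℝ] x₂) (y₁ ⊗ₜ[ℝ] y₂) = G₁ x₁ y₁ * G₂ x₂ y₂ := hB _ _ _ _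
  refine ⟨(p₁.sl2.map ρ₁).add (p₂.sl2.map ρ₂) (comm _ _) (comm _ _) (comm _ _) (comm _ _),
    ?_, ?_, ?_, ?_, ?_, ?_, ?_⟩
  · intro i
    rw [IsSl2Pair.add_bracket (comm _ _) (comm _ _), ← map_mul, ← map_mul, ← map_mul, ← map_mul,
      ← map_sub, ← map_sub]
    suffices H i ≤ LinearMap.eqLocus (ρ₁ (e₁ * f₁ - f₁ * e₁) + ρ₂ (e₂ * f₂ - f₂ * e₂))
        ((i - (n₁ + n₂ : ℕ) : ℝ) • LinearMap.id) from fun x hx => this hx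
    refine tensorGrading_le hH fun a b hab x hx y hy => ?_
    rw [LinearMap.mem_eqLocus, LinearMap.add_apply, hρ₁, hρ₂, p₁.weight a x hx,
      p₂.weight b y hy, ← TensorProduct.smul_tmul', TensorProduct.tmul_smul, LinearMap.smul_apply,
      LinearMap.id_apply, ← add_smul, ← hab]
    congr 1
    push_cast
    ring
  · rw [mul_assoc, ← mul_assoc (ρ₂ c₂), ← (comm c₁ c₂).eq, mul_assoc, ← map_mul, ← mul_assoc,
      ← map_mul, p₁.c_mul_c, p₂.c_mul_c, map_one, map_one, one_mul]
  · have h₁ (x) : c₁ (e₁ x) = -e₁ (c₁ x) := LinearMap.congr_fun p₁.c_mul_e x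
    have h₂ (x) : c₂ (e₂ x) = -e₂ (c₂ x) := LinearMap.congr_fun p₂.c_mul_e x
    refine TensorProduct.ext' fun x y => ?_
    simp [hρ₁, hρ₂, h₁, h₂, TensorProduct.neg_tmul, TensorProduct.tmul_neg]
    abel
  · have h₁ (x) : c₁ (f₁ x) = -f₁ (c₁ x) := LinearMap.congr_fun p₁.c_mul_f x
    have h₂ (x) : c₂ (f₂ x) = -f₂ (c₂ x) := LinearMap.congr_fun p₂.c_mul_f x
    refine TensorProduct.ext' fun x y => ?_
    simp [hρ₁, hρ₂, h₁, h₂, TensorProduct.neg_tmul, TensorProduct.tmul_neg]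
    abel
  · intro i
    suffices H (2 * i) ≤ LinearMap.eqLocus (ρ₁ c₁ * ρ₂ c₂) ((-1 : ℝ) ^ i • LinearMap.id) from
      fun x hx => this hx
    refine tensorGrading_le hH fun a b hab x hx y hy => ?_
    rw [LinearMap.mem_eqLocus, Module.End.mul_apply, hρ₂, hρ₁, LinearMap.smul_apply,
      LinearMap.id_apply]
    rcases Int.even_or_odd' a with ⟨k, rfl | rfl⟩
    · obtain rfl : b = 2 * (i - k) := by omega
      rw [p₁.c_apply k x hx, p₂.c_apply _ y hy, TensorProduct.smul_tmul_smul,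
        ← zpow_add₀ (by norm_num), add_sub_cancel]
    · rw [odd₁ _ ⟨k, rfl⟩, Submodule.mem_bot] at hx
      simp [hx]
  · rw [hweyl]
    exact tensorForm_symm hG p₁.form_symm p₂.form_symm
  · rw [hweyl]
    exact fun x hx => tensorForm_pos hG p₁.form_symm p₂.form_symm p₁.form_pos p₂.form_pos hx

/-- The primitive subspace in degree `d`. -/
def primitive {V : Type} [AddCommGroup V] [Module ℝ V] (n : ℕ) (H : ℤ → Submodule ℝ V)
    (l : Module.End ℝ V) (d : ℕ) : Submodule ℝ V :=
  H d ⊓ LinearMap.ker (l ^ (n - d + 1))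

theorem exists_gradingOperator {V : Type} [AddCommGroup V] [Module ℝ V]
    {H : ℤ → Submodule ℝ V} (h : DirectSum.IsInternal H) (a : ℤ → ℝ) :
    ∃ T : Module.End ℝ V, ∀ i, ∀ x ∈ H i, T x = a i • x := by
  let Φ := LinearEquiv.ofBijective (DirectSum.coeLinearMap H) h
  refine ⟨DirectSum.toModule ℝ ℤ V (fun i => a i • (H i).subtype) ∘ₗ Φ.symm, fun i x hx => ?_⟩
  have hΦ : Φ.symm x = DirectSum.lof ℝ ℤ (fun i => H i) i ⟨x, hx⟩ := by
    rw [LinearEquiv.symm_apply_eq]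
    exact (DirectSum.coeLinearMap_lof H i ⟨x, hx⟩).symm
  rw [LinearMap.comp_apply, LinearEquiv.coe_coe, hΦ, DirectSum.toModule_lof]
  rfl

theorem bilinForm_pos_of_orthogonal {V : Type*} [AddCommGroup V] [Module ℝ V] {ι : Type*}
    {M : ι → Submodule ℝ V} (hM : ⨆ q, M q = ⊤) {G : LinearMap.BilinForm ℝ V}
    (horth : ∀ q r, q ≠ r → ∀ x ∈ M q, ∀ y ∈ M r, G x y = 0)
    (hpos : ∀ q, ∀ x ∈ M q, x ≠ 0 → 0 < G x x) {x : V} (hx : x ≠ 0) : 0 < G x x := by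
  obtain ⟨z, hz, rfl⟩ := (Submodule.mem_iSup_iff_exists_finsupp M x).mp (hM ▸ Submodule.mem_top)
  have hG : G (z.sum fun _ y => y) (z.sum fun _ y => y) = ∑ q ∈ z.support, G (z q) (z q) := by
    simp only [Finsupp.sum, map_sum, LinearMap.sum_apply]
    refine Finset.sum_congr rfl fun q hq => Finset.sum_eq_single q (fun r _ hr => ?_) ?_
    · exact horth r q hr _ (hz r) _ (hz q)
    · exact fun h => absurd hq h
  rw [hG]
  refine Finset.sum_pos (fun q hq => hpos q _ (hz q) (Finsupp.mem_support_iff.mp hq)) ?_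
  rw [Finsupp.support_nonempty_iff]
  rintro rfl
  exact hx (Finsupp.sum_zero_index)

namespace IsPLSpace

variable {V : Type} [AddCommGroup V] [Module ℝ V] {n : ℕ} {H : ℤ → Submodule ℝ V}
  {B : LinearMap.BilinForm ℝ V} {l : Module.End ℝ V}

theorem pow_mem (hp : IsPLSpace n H B l) {i : ℤ} {x : V} (hx : x ∈ H i) (k : ℕ) :
    (l ^ k) x ∈ H (i + 2 * k) := by
  induction k with
  | zero => simpa using hx
  | succ k ih =>
    rw [pow_succ', Module.End.mul_apply]
    have := hp.deg2 _ (Submodule.mem_map_of_mem ih)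
    rwa [show i + 2 * (k : ℤ) + 2 = i + 2 * (k + 1 : ℕ) by push_cast; ring] at this

theorem primitive_pow_eq_zero {d j : ℕ} {x : V} (hx : x ∈ primitive n H l d) (hj : n - d < j) :
    (l ^ j) x = 0 := by
  have h : (l ^ (n - d + 1)) x = 0 := hx.2
  obtain ⟨k, rfl⟩ := Nat.exists_eq_add_of_le hj
  rw [Nat.add_comm, pow_add, Module.End.mul_apply, h, map_zero]

theorem eq_zero_of_odd (hp : IsPLSpace n H B l) {d : ℕ} (hd : Odd d) {x : V} (hx : x ∈ H d) :
    x = 0 := by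
  rwa [hp.oddVanish d (by exact_mod_cast hd), Submodule.mem_bot] at hx

theorem primitive_pos (hp : IsPLSpace n H B l) (hr : SatisfiesHRM n H B l) {d : ℕ} (hd : d ≤ n)
    {x : V} (hx : x ∈ primitive n H l d) (hx0 : x ≠ 0) :
    0 < (-1 : ℝ) ^ (d / 2) * B ((l ^ (n - d)) x) x := by
  rcases Nat.even_or_odd d with h | h
  · exact hr d hd h x hx hx0
  · exact absurd (hp.eq_zero_of_odd h hx.1) hx0

theorem eq_zero_of_pow (hp : IsPLSpace n H B l) (hr : SatisfiesHRM n H B l) {d : ℕ} (hd : d ≤ n)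
    {x : V} (hx : x ∈ H d) (h0 : (l ^ (n - d)) x = 0) : x = 0 := by
  by_contra hne
  have hprim : x ∈ primitive n H l d :=
    ⟨hx, LinearMap.mem_ker.mpr (by rw [pow_succ', Module.End.mul_apply, h0, map_zero])⟩
  have := hp.primitive_pos hr hd hprim hne
  simp [h0] at this

theorem exists_pow_eq (hp : IsPLSpace n H B l) (hr : SatisfiesHRM n H B l) {d : ℕ} (hd : d ≤ n)
    {z : V} (hz : z ∈ H (2 * n - d)) : ∃ x ∈ H d, (l ^ (n - d)) x = z := by
  have := hp.finite
  have hmaps : ∀ x ∈ H d, (l ^ (n - d)) x ∈ H (2 * n - d) := fun x hx => by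
    have := hp.pow_mem hx (n - d)
    rwa [show (d : ℤ) + 2 * (n - d : ℕ) = 2 * n - d by omega] at this
  let L : H d →ₗ[ℝ] H (2 * n - d) := (l ^ (n - d)).restrict hmaps
  have hL : Function.Injective L := by
    rw [← LinearMap.ker_eq_bot, LinearMap.ker_eq_bot']
    intro x hx
    exact Subtype.ext (hp.eq_zero_of_pow hr hd x.2 (congrArg Subtype.val hx))
  let D : H (2 * n - d) →ₗ[ℝ] Module.Dual ℝ (H d) :=
    (H d).subtype.dualMap ∘ₗ B ∘ₗ (H (2 * n - d)).subtype
  have hD : Function.Injective D := by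
    rw [← LinearMap.ker_eq_bot, LinearMap.ker_eq_bot']
    intro y hy
    refine Subtype.ext (hp.nondeg _ y y.2 fun x hx => ?_)
    rw [sub_sub_cancel] at hx
    exact LinearMap.congr_fun hy ⟨x, hx⟩
  have hfin : Module.finrank ℝ (H d) = Module.finrank ℝ (H (2 * n - d)) := by
    refine le_antisymm (LinearMap.finrank_le_finrank_of_injective hL) ?_
    rw [← Subspace.dual_finrank_eq (K := ℝ) (V := H d)]
    exact LinearMap.finrank_le_finrank_of_injective hD
  obtain ⟨x, hx⟩ := (LinearMap.injective_iff_surjective_of_finrank_eq_finrank hfin).mp hL ⟨z, hz⟩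
  exact ⟨x, x.2, congrArg Subtype.val hx⟩

theorem mem_of_primitive (hp : IsPLSpace n H B l) (hr : SatisfiesHRM n H B l)
    {W : Submodule ℝ V} (hW : ∀ d j : ℕ, d + j ≤ n → ∀ x ∈ primitive n H l d, (l ^ j) x ∈ W)
    (x : V) : x ∈ W := by
  have hlow (d : ℕ) : d ≤ n → ∀ x ∈ H d, ∀ j : ℕ, (l ^ j) x ∈ W := by
    induction d using Nat.strong_induction_on with
    | _ d ih =>
    intro hd x hx j
    have hprim (p) (hpp : p ∈ primitive n H l d) : (l ^ j) p ∈ W := by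
      by_cases hj : j ≤ n - d
      · exact hW d j (by omega) p hpp
      · rw [primitive_pow_eq_zero hpp (by omega)]
        exact W.zero_mem
    have hz := hp.pow_mem hx (n - d + 1)
    by_cases hd2 : d < 2
    · rw [hp.bound _ (Or.inr (by omega)), Submodule.mem_bot] at hz
      exact hprim x ⟨hx, hz⟩
    · obtain ⟨k, rfl⟩ := Nat.exists_eq_add_of_le' (not_lt.mp hd2)
      rw [show ((k + 2 : ℕ) : ℤ) + 2 * (n - (k + 2) + 1 : ℕ) = 2 * n - k by omega] at hz
      obtain ⟨y, hy, hyz⟩ := hp.exists_pow_eq hr (by omega) hz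
      have hly : l y ∈ H (k + 2 : ℕ) := hp.deg2 _ (Submodule.mem_map_of_mem hy)
      have h0 : (l ^ (n - (k + 2) + 1)) (x - l y) = 0 := by
        rw [map_sub, ← Module.End.mul_apply _ l, ← pow_succ,
          show n - (k + 2) + 1 + 1 = n - k by omega, hyz, sub_self]
      have h1 := W.add_mem (hprim (x - l y) ⟨Submodule.sub_mem _ hx hly, h0⟩)
        (ih k (by omega) (by omega) y hy (j + 1))
      rwa [pow_succ, Module.End.mul_apply, ← map_add, sub_add_cancel] at h1
  have htop : ⨆ i, H i = ⊤ := hp.internal.submodule_iSup_eq_top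
  suffices h : ⨆ i, H i ≤ W from h (htop ▸ Submodule.mem_top)
  refine iSup_le fun i x hx => ?_
  by_cases hi : i < 0 ∨ 2 * n < i
  · rw [hp.bound i hi, Submodule.mem_bot] at hx
    exact hx ▸ W.zero_mem
  · rcases le_or_gt i n with h | h
    · lift i to ℕ using by omega
      exact hlow i (by omega) x hx 0
    · obtain ⟨d, hd⟩ := Int.eq_ofNat_of_zero_le (show 0 ≤ 2 * n - i by omega)
      obtain rfl : i = 2 * n - d := by omega
      obtain ⟨y, hy, rfl⟩ := hp.exists_pow_eq hr (by omega) hx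
      exact hlow d (by omega) y hy _

theorem end_ext (hp : IsPLSpace n H B l) (hr : SatisfiesHRM n H B l) {S T : Module.End ℝ V}
    (h : ∀ d j : ℕ, d + j ≤ n → ∀ x ∈ primitive n H l d, S ((l ^ j) x) = T ((l ^ j) x)) :
    S = T :=
  LinearMap.ext (hp.mem_of_primitive hr (W := LinearMap.eqLocus S T) h)

theorem primitive_orthog (hp : IsPLSpace n H B l) {d d' j k : ℕ} (hd : d ≤ n) (hd' : d' ≤ n)
    (h : d = d' → j + k ≠ n - d) {x y : V} (hx : x ∈ primitive n H l d)
    (hy : y ∈ primitive n H l d') : B ((l ^ j) x) ((l ^ k) y) = 0 := by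
  by_contra hne
  have h1 : (d + 2 * j + (d' + 2 * k) : ℤ) = 2 * n := by
    by_contra hdeg
    exact hne (hp.orthog _ _ hdeg _ (hp.pow_mem hx.1 j) _ (hp.pow_mem hy.1 k))
  have h2 : j + k ≤ n - d := by
    by_contra! hlt
    refine hne ?_
    rw [← selfAdjoint_pow hp.selfAdjoint, ← Module.End.mul_apply, ← pow_add,
      primitive_pow_eq_zero hx (by omega), map_zero, LinearMap.zero_apply]
  have h3 : j + k ≤ n - d' := by
    by_contra! hlt
    refine hne ?_
    rw [selfAdjoint_pow hp.selfAdjoint, ← Module.End.mul_apply, ← pow_add,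
      primitive_pow_eq_zero hy (by omega), map_zero]
  omega

theorem exists_end_apply_primitive (hp : IsPLSpace n H B l) (hr : SatisfiesHRM n H B l)
    (g : ℕ → ℕ → Module.End ℝ V) :
    ∃ T : Module.End ℝ V, ∀ d j : ℕ, d + j ≤ n → ∀ x ∈ primitive n H l d,
      T ((l ^ j) x) = g d j x := by
  let ι := {q : ℕ × ℕ // q.1 + q.2 ≤ n}
  let M (q : ι) := primitive n H l q.1.1
  let Φ : DirectSum ι (fun q => M q) →ₗ[ℝ] V :=
    DirectSum.toModule ℝ ι V fun q => (l ^ q.1.2) ∘ₗ (M q).subtype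
  have hΦ (q : ι) (y : V) (hy : y ∈ M q) :
      Φ (DirectSum.lof ℝ ι (fun q => M q) q ⟨y, hy⟩) = (l ^ q.1.2) y :=
    DirectSum.toModule_lof ℝ q _
  have hinj : Function.Injective Φ := by
    rw [← LinearMap.ker_eq_bot, LinearMap.ker_eq_bot']
    intro x hx
    ext q
    by_contra hne
    let k := n - q.1.1 - q.1.2
    have hq := q.2
    have hpair : B.flip ((l ^ k) (x q)) ∘ₗ Φ =
        B.flip ((l ^ k) (x q)) ∘ₗ (l ^ q.1.2) ∘ₗ (M q).subtype ∘ₗ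
          DirectSum.component ℝ ι (fun q => M q) q := by
      refine DirectSum.linearMap_ext ℝ fun r => LinearMap.ext fun y => ?_
      by_cases hqr : r = q
      · subst hqr
        simp [hΦ r y y.2]
      · have h0 : B ((l ^ r.1.2) y) ((l ^ k) (x q)) = 0 := by
          have hr := r.2
          refine hp.primitive_orthog (by omega) (by omega) (fun h h' => hqr ?_) y.2 (x q).2
          exact Subtype.ext (Prod.ext h (by omega))
        simp [hΦ r y y.2, h0, DirectSum.component.of, hqr]
    have h1 := LinearMap.congr_fun hpair x
    simp only [LinearMap.comp_apply, hx, map_zero] at h1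
    have h2 : B ((l ^ (n - q.1.1)) (x q)) (x q) = 0 := by
      rw [show n - q.1.1 = k + q.1.2 by omega, pow_add, Module.End.mul_apply,
        selfAdjoint_pow hp.selfAdjoint]
      exact h1.symm
    have h3 := hp.primitive_pos hr (by omega) (x q).2 fun h => hne h
    rw [h2, mul_zero] at h3
    exact h3.false
  have hsurj : Function.Surjective Φ := fun x =>
    hp.mem_of_primitive hr (W := LinearMap.range Φ)
      (fun d j hdj x hx => ⟨_, hΦ ⟨(d, j), hdj⟩ x hx⟩) x
  let Ψ := LinearEquiv.ofBijective Φ ⟨hinj, hsurj⟩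
  refine ⟨DirectSum.toModule ℝ ι V (fun q => g q.1.1 q.1.2 ∘ₗ (M q).subtype) ∘ₗ Ψ.symm,
    fun d j hdj x hx => ?_⟩
  have hΨ : Ψ.symm ((l ^ j) x) = DirectSum.lof ℝ ι (fun q => M q) ⟨(d, j), hdj⟩ ⟨x, hx⟩ := by
    rw [LinearEquiv.symm_apply_eq]
    exact (hΦ ⟨(d, j), hdj⟩ x hx).symm
  rw [LinearMap.comp_apply, LinearEquiv.coe_coe, hΨ, DirectSum.toModule_lof]
  rfl

end IsPLSpace

namespace IsPLSpace

variable {V : Type} [AddCommGroup V] [Module ℝ V] {n : ℕ} {H : ℤ → Submodule ℝ V}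
  {B : LinearMap.BilinForm ℝ V} {l : Module.End ℝ V}

theorem isNilpotent (hp : IsPLSpace n H B l) : IsNilpotent l := by
  refine ⟨2 * n + 1, LinearMap.ext fun x => ?_⟩
  have htop : ⨆ i, H i = ⊤ := hp.internal.submodule_iSup_eq_top
  suffices h : ⨆ i, H i ≤ LinearMap.ker (l ^ (2 * n + 1)) from
    LinearMap.mem_ker.mp (h (htop ▸ Submodule.mem_top))
  refine iSup_le fun i x hx => LinearMap.mem_ker.mpr ?_
  by_cases hi : i < 0
  · rw [hp.bound i (Or.inl hi), Submodule.mem_bot] at hx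
    rw [hx, map_zero]
  · have h := hp.pow_mem hx (2 * n + 1)
    rwa [hp.bound _ (Or.inr (by push_cast; omega)), Submodule.mem_bot] at h

/-- `f` lowers the strings generated by primitive vectors as the operator of an `𝔰𝔩₂`-action. -/
def IsLowering (n : ℕ) (H : ℤ → Submodule ℝ V) (l f : Module.End ℝ V) : Prop :=
  ∀ d j : ℕ, d + j ≤ n → ∀ x ∈ primitive n H l d,
    f ((l ^ j) x) = (j * (n - d - j + 1) : ℝ) • (l ^ (j - 1)) x

theorem bracket_apply_primitive {f : Module.End ℝ V} (hf : IsLowering n H l f) {d j : ℕ}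
    (hdj : d + j ≤ n) {x : V} (hx : x ∈ primitive n H l d) :
    (l * f - f * l) ((l ^ j) x) = (d + 2 * j - n : ℝ) • (l ^ j) x := by
  have h1 : l (f ((l ^ j) x)) = (j * (n - d - j + 1) : ℝ) • (l ^ j) x := by
    rw [hf d j hdj x hx, map_smul]
    rcases j with - | j
    · simp
    · rw [Nat.add_sub_cancel, ← Module.End.mul_apply, ← pow_succ']
  have h2 : f (l ((l ^ j) x)) = ((j + 1) * (n - d - j) : ℝ) • (l ^ j) x := by
    rw [← Module.End.mul_apply l, ← pow_succ']
    by_cases hj : d + j = n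
    · rw [primitive_pow_eq_zero hx (by omega), map_zero, ← hj]
      simp
    · rw [hf d (j + 1) (by omega) x hx, Nat.add_sub_cancel]
      push_cast
      congr 1
      ring
  rw [LinearMap.sub_apply, Module.End.mul_apply, Module.End.mul_apply, h1, h2, ← sub_smul]
  congr 1
  ring

theorem lowering_pow_apply {f : Module.End ℝ V} (hf : IsLowering n H l f) {d j : ℕ}
    (hdj : d + j ≤ n) {x : V} (hx : x ∈ primitive n H l d) :
    (f ^ (j + 1)) ((l ^ j) x) = 0 := by
  induction j with
  | zero => rw [zero_add, pow_one, hf d 0 hdj x hx, Nat.cast_zero, zero_mul, zero_smul]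
  | succ j ih =>
    rw [pow_succ, Module.End.mul_apply, hf d (j + 1) hdj x hx, map_smul, Nat.add_sub_cancel,
      ih (by omega), smul_zero]

theorem bracket_apply (hp : IsPLSpace n H B l) (hr : SatisfiesHRM n H B l)
    {f : Module.End ℝ V} (hf : IsLowering n H l f) (i : ℤ) {x : V} (hx : x ∈ H i) :
    (l * f - f * l) x = (i - n : ℝ) • x := by
  obtain ⟨T, hT⟩ := exists_gradingOperator hp.internal fun i => (i - n : ℝ)
  rw [← hT i x hx]
  refine LinearMap.congr_fun (hp.end_ext hr fun d j hdj y hy => ?_) x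
  rw [bracket_apply_primitive hf hdj hy, hT _ _ (hp.pow_mem hy.1 j)]
  push_cast
  rfl

theorem isSl2Pair (hp : IsPLSpace n H B l) (hr : SatisfiesHRM n H B l)
    {f : Module.End ℝ V} (hf : IsLowering n H l f) : IsSl2Pair l f where
  nilpotent_e := hp.isNilpotent
  nilpotent_f := by
    refine ⟨n + 1, hp.end_ext hr fun d j hdj x hx => ?_⟩
    rw [show n + 1 = (n - j) + (j + 1) by omega, pow_add, Module.End.mul_apply,
      lowering_pow_apply hf hdj hx, map_zero, LinearMap.zero_apply]
  h_mul_e := by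
    refine hp.end_ext hr fun d j hdj x hx => ?_
    have h1 := hp.bracket_apply hr hf _ (hp.pow_mem hx.1 (j + 1))
    rw [pow_succ', Module.End.mul_apply] at h1
    rw [Module.End.mul_apply, h1, LinearMap.add_apply, Module.End.mul_apply,
      bracket_apply_primitive hf hdj hx, map_smul, LinearMap.smul_apply, ← add_smul]
    push_cast
    congr 1
    ring
  h_mul_f := by
    refine hp.end_ext hr fun d j hdj x hx => ?_
    rw [Module.End.mul_apply, LinearMap.sub_apply (f * _), Module.End.mul_apply f,
      bracket_apply_primitive hf hdj hx, map_smul, LinearMap.smul_apply, ← sub_smul,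
      hf d j hdj x hx, map_smul]
    rcases j with - | j
    · simp
    · rw [Nat.add_sub_cancel, bracket_apply_primitive hf (by omega) hx, smul_comm]
      push_cast
      congr 1
      ring

theorem weyl_apply_primitive {f : Module.End ℝ V} (s : IsSl2Pair l f)
    (hf : IsLowering n H l f) {d j : ℕ} (hdj : d + j ≤ n) {x : V}
    (hx : x ∈ primitive n H l d) :
    weyl l f ((l ^ j) x) =
      ((-1) ^ j * j.factorial / (n - d - j).factorial : ℝ) • (l ^ (n - d - j)) x := by
  induction j with
  | zero =>
    have h1 := hf d 0 hdj x hx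
    have h2 := bracket_apply_primitive hf hdj hx
    have h3 : (l ^ (n - d + 1)) x = 0 := hx.2
    simp only [pow_zero, Module.End.one_apply, Nat.cast_zero, zero_mul, zero_smul, mul_zero,
      add_zero] at h1 h2
    rw [show (d - n : ℝ) = -(n - d : ℕ) by rw [Nat.cast_sub (by omega)]; ring] at h2
    simp [s.weyl_apply h1 h2 h3]
  | succ j ih =>
    have h := LinearMap.congr_fun s.f_mul_weyl ((l ^ j) x)
    rw [LinearMap.neg_apply, Module.End.mul_apply, Module.End.mul_apply,
      ih (by omega), map_smul, hf d _ (by omega) x hx] at h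
    rw [pow_succ', Module.End.mul_apply, ← neg_eq_iff_eq_neg.mpr h, smul_smul, ← neg_smul,
      show n - d - j - 1 = n - d - (j + 1) by omega]
    congr 1
    obtain ⟨k, rfl⟩ := Nat.exists_eq_add_of_le hdj
    rw [show d + (j + 1) + k - d - j = k + 1 by omega,
      show d + (j + 1) + k - d - (j + 1) = k by omega, Nat.factorial_succ, Nat.factorial_succ]
    push_cast
    field_simp
    ring

theorem exists_isPolarization (hp : IsPLSpace n H B l) (hr : SatisfiesHRM n H B l) :
    ∃ f c, IsPolarization n H B l f c := by
  obtain ⟨f, hf⟩ : ∃ f, IsLowering n H l f :=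
    hp.exists_end_apply_primitive hr fun d j => (j * (n - d - j + 1) : ℝ) • l ^ (j - 1)
  obtain ⟨c, hc⟩ := exists_gradingOperator hp.internal fun i => (-1 : ℝ) ^ (i / 2)
  have s := hp.isSl2Pair hr hf
  have hcl {d : ℕ} (j : ℕ) {x : V} (hx : x ∈ primitive n H l d) :
      c ((l ^ j) x) = (-1 : ℝ) ^ (d / 2 + j) • (l ^ j) x := by
    rw [hc _ _ (hp.pow_mem hx.1 j), ← zpow_natCast]
    congr 2
    omega
  have hcc : c * c = 1 := by
    refine hp.end_ext hr fun d j hdj x hx => ?_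
    rw [Module.End.mul_apply, hcl j hx, map_smul, hcl j hx, smul_smul, ← mul_pow]
    simp
  have hform {d d' j k : ℕ} (hdj : d + j ≤ n) (hdk : d' + k ≤ n) {x y : V}
      (hx : x ∈ primitive n H l d) (hy : y ∈ primitive n H l d') :
      B (c ((l ^ j) x)) (weyl l f ((l ^ k) y)) =
        ((-1) ^ (d / 2 + j + k) * (k.factorial / (n - d' - k).factorial) : ℝ) *
          B ((l ^ j) x) ((l ^ (n - d' - k)) y) := by
    rw [hcl j hx, weyl_apply_primitive s hf hdk hy, map_smul, map_smul, LinearMap.smul_apply,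
      smul_eq_mul, smul_eq_mul]
    ring
  have hform_ne {d d' j k : ℕ} (hdj : d + j ≤ n) (hdk : d' + k ≤ n) (hne : ¬(d = d' ∧ j = k))
      {x y : V} (hx : x ∈ primitive n H l d) (hy : y ∈ primitive n H l d') :
      B (c ((l ^ j) x)) (weyl l f ((l ^ k) y)) = 0 := by
    rw [hform hdj hdk hx hy, hp.primitive_orthog (by omega) (by omega) (by omega) hx hy, mul_zero]
  have hform_eq {d j : ℕ} (hdj : d + j ≤ n) {x y : V} (hx : x ∈ primitive n H l d)
      (hy : y ∈ primitive n H l d) :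
      B (c ((l ^ j) x)) (weyl l f ((l ^ j) y)) =
        (j.factorial / (n - d - j).factorial : ℝ) *
          ((-1) ^ (d / 2) * B ((l ^ (n - d)) x) y) := by
    rw [hform hdj hdj hx hy, ← selfAdjoint_pow hp.selfAdjoint, ← Module.End.mul_apply, ← pow_add,
      Nat.sub_add_cancel (by omega), add_assoc, pow_add, Even.neg_one_pow ⟨j, rfl⟩]
    ring
  let G : LinearMap.BilinForm ℝ V := B.compl₁₂ c (weyl l f)
  refine ⟨f, c, s, fun i x hx => hp.bracket_apply hr hf i hx, hcc, ?_, ?_, ?_, ?_, ?_⟩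
  · refine hp.end_ext hr fun d j hdj x hx => ?_
    have h := hcl (j + 1) hx
    rw [pow_succ', Module.End.mul_apply] at h
    rw [Module.End.mul_apply, h, LinearMap.neg_apply, Module.End.mul_apply, hcl j hx, map_smul,
      ← add_assoc, pow_succ, mul_neg_one, neg_smul]
  · refine hp.end_ext hr fun d j hdj x hx => ?_
    rw [LinearMap.neg_apply, Module.End.mul_apply, Module.End.mul_apply, hcl j hx, map_smul,
      hf d j hdj x hx, map_smul]
    rcases j with - | j
    · simp
    · rw [Nat.add_sub_cancel, hcl j hx, ← add_assoc, pow_succ]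
      module
  · intro i x hx
    rw [hc _ x hx, Int.mul_ediv_cancel_left _ two_ne_zero]
  · suffices h : G = G.flip from fun x y => LinearMap.congr_fun (LinearMap.congr_fun h x) y
    refine LinearMap.ext fun x => hp.mem_of_primitive hr
      (W := LinearMap.eqLocus G G.flip) (fun d j hdj x hx => LinearMap.ext fun y => ?_) x
    refine hp.mem_of_primitive hr (W := LinearMap.eqLocus (G ((l ^ j) x)) (G.flip ((l ^ j) x)))
      (fun d' k hdk y hy => ?_) y
    change B (c ((l ^ j) x)) (weyl l f ((l ^ k) y)) = B (c ((l ^ k) y)) (weyl l f ((l ^ j) x))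
    by_cases h : d = d' ∧ j = k
    · obtain ⟨rfl, rfl⟩ := h
      rw [hform_eq hdj hx hy, hform_eq hdj hy hx, selfAdjoint_pow hp.selfAdjoint, hp.symm]
    · rw [hform_ne hdj hdk h hx hy, hform_ne hdk hdj (fun h' => h ⟨h'.1.symm, h'.2.symm⟩) hy hx]
  · intro x hx
    let M (q : {q : ℕ × ℕ // q.1 + q.2 ≤ n}) := (primitive n H l q.1.1).map (l ^ q.1.2)
    refine bilinForm_pos_of_orthogonal (M := M) (G := G) ?_ ?_ ?_ hx
    · refine eq_top_iff.mpr fun y _ => hp.mem_of_primitive hr (fun d j hdj x hx => ?_) y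
      exact Submodule.mem_iSup_of_mem ⟨(d, j), hdj⟩ (Submodule.mem_map_of_mem hx)
    · rintro ⟨⟨d, j⟩, hdj⟩ ⟨⟨d', k⟩, hdk⟩ hne - ⟨x, hx, rfl⟩ - ⟨y, hy, rfl⟩
      refine hform_ne hdj hdk (fun h => hne ?_) hx hy
      exact Subtype.ext (Prod.ext h.1 h.2)
    · rintro ⟨⟨d, j⟩, hdj⟩ - ⟨x, hx, rfl⟩ hne
      have h := hp.primitive_pos hr (le_of_add_le_left hdj) hx fun h =>
        hne (by rw [h, map_zero])
      exact (hform_eq hdj hx hx).symm ▸ mul_pos (by positivity) h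

end IsPLSpace

/-- The tensor product of two Poincaré–Lefschetz spaces satisfying the
Hodge–Riemann–Minkowski relations, with grading `H^i = ⊕_{a+b=i} H₁^a ⊗ H₂^b`,
form `⟨x₁ ⊗ x₂, y₁ ⊗ y₂⟩ = ⟨x₁,y₁⟩₁⟨x₂,y₂⟩₂` and operator
`l = l₁ ⊗ id + id ⊗ l₂`, is a Poincaré–Lefschetz space of dimension `n₁ + n₂`
satisfying the Hodge–Riemann–Minkowski relations. -/
theorem stmt6 {V₁ V₂ : Type} [AddCommGroup V₁] [Module ℝ V₁]
    [AddCommGroup V₂] [Module ℝ V₂]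
    (n₁ n₂ : ℕ) (H₁ : ℤ → Submodule ℝ V₁) (H₂ : ℤ → Submodule ℝ V₂)
    (B₁ : LinearMap.BilinForm ℝ V₁) (B₂ : LinearMap.BilinForm ℝ V₂)
    (l₁ : Module.End ℝ V₁) (l₂ : Module.End ℝ V₂)
    (hPL₁ : IsPLSpace n₁ H₁ B₁ l₁) (hPL₂ : IsPLSpace n₂ H₂ B₂ l₂)
    (hHRM₁ : SatisfiesHRM n₁ H₁ B₁ l₁) (hHRM₂ : SatisfiesHRM n₂ H₂ B₂ l₂)
    (B : LinearMap.BilinForm ℝ (V₁ ⊗[ℝ] V₂))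
    (hB : ∀ (x₁ y₁ : V₁) (x₂ y₂ : V₂),
      B (x₁ ⊗ₜ[ℝ] x₂) (y₁ ⊗ₜ[ℝ] y₂) = B₁ x₁ y₁ * B₂ x₂ y₂)
    (H : ℤ → Submodule ℝ (V₁ ⊗[ℝ] V₂))
    (hH : ∀ i : ℤ, H i = ⨆ a : ℤ,
      LinearMap.range (TensorProduct.map ((H₁ a).subtype) ((H₂ (i - a)).subtype)))
    (l : Module.End ℝ (V₁ ⊗[ℝ] V₂))
    (hl : l = TensorProduct.map (l₁ : V₁ →ₗ[ℝ] V₁) LinearMap.id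
            + TensorProduct.map LinearMap.id (l₂ : V₂ →ₗ[ℝ] V₂)) :
    IsPLSpace (n₁ + n₂) H B l ∧ SatisfiesHRM (n₁ + n₂) H B l := by
  have := hPL₁.finite
  have := hPL₂.finite
  obtain ⟨f₁, c₁, p₁⟩ := hPL₁.exists_isPolarization hHRM₁
  obtain ⟨f₂, c₂, p₂⟩ := hPL₂.exists_isPolarization hHRM₂
  have p := p₁.tensor p₂ hPL₁.oddVanish hB hH
  have hl' : Module.End.rTensorAlgHom ℝ V₁ V₂ l₁ + Module.End.lTensorAlgHom ℝ V₂ V₁ l₂ = l :=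
    hl.symm
  rw [hl'] at p
  have hl_tmul (x : V₁) (y : V₂) : l (x ⊗ₜ[ℝ] y) = l₁ x ⊗ₜ[ℝ] y + x ⊗ₜ[ℝ] l₂ y := by simp [hl]
  have he (x y : V₁ ⊗[ℝ] V₂) : B (l x) y = B x (l y) := by
    have : B.compl₁₂ l LinearMap.id = B.compl₁₂ LinearMap.id l := by
      ext x₁ x₂ y₁ y₂
      simp [hl_tmul, hB, hPL₁.selfAdjoint, hPL₂.selfAdjoint]
    exact LinearMap.congr_fun (LinearMap.congr_fun this x) y
  have hbot {i : ℤ} (h : ∀ a b : ℤ, a + b = i → H₁ a = ⊥ ∨ H₂ b = ⊥) : H i = ⊥ := by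
    refine eq_bot_iff.mpr (tensorGrading_le hH fun a b hab x hx y hy => ?_)
    rcases h a b hab with h | h
    · rw [h, Submodule.mem_bot] at hx
      simp [hx]
    · rw [h, Submodule.mem_bot] at hy
      simp [hy]
  refine ⟨p.isPLSpace ?_ (fun i hi => hbot fun a b hab => ?_) (fun i hi => hbot fun a b hab => ?_)
    (tensorForm_symm hB hPL₁.symm hPL₂.symm) (fun i => ?_) he, p.satisfiesHRM he⟩
  · exact iSup_tensorGrading hH hPL₁.internal.submodule_iSup_eq_top
      hPL₂.internal.submodule_iSup_eq_top
  · by_cases ha : a < 0 ∨ 2 * n₁ < a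
    · exact Or.inl (hPL₁.bound a ha)
    · refine Or.inr (hPL₂.bound b ?_)
      push_cast at hi
      omega
  · rcases Int.even_or_odd a with ha | ha
    · exact Or.inr (hPL₂.oddVanish b (by rw [← hab, Int.odd_add] at hi; grind))
    · exact Or.inl (hPL₁.oddVanish a ha)
  · refine Submodule.map_le_iff_le_comap.mpr (tensorGrading_le hH fun a b hab x hx y hy => ?_)
    rw [Submodule.mem_comap, hl_tmul]
    exact add_mem
      (tmul_mem_tensorGrading hH (by omega) (hPL₁.deg2 a (Submodule.mem_map_of_mem hx)) hy)
      (tmul_mem_tensorGrading hH (by omega) hx (hPL₂.deg2 b (Submodule.mem_map_of_mem hy)))
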